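/- (Puig's reducibility lemma) Let α ∈ ℝ be Diophantine and δ > 0. Suppose A : ℝ → SL(2, ℝ) is 1-periodic and each entry of A extends to a holomorphic function on the strip {z : |Im z| < δ}; suppose v : ℝ → ℝ² is 1-periodic, v(ω) ≠ 0 for every ω, each component of v extends holomorphically to the same strip, and v(ω + α) = A(ω) v(ω) for every ω ∈ ℝ. Then there exist a real number c and a 1-periodic map B : ℝ → SL(2, ℝ), each entry of which extends holomorphically to the strip {z : |Im z| < δ}, such that B(ω + α)^{−1} A(ω) B(ω) = [[1, c], [0, 1]] for every ω ∈ ℝ. -/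

import Mathlib

/-- A function `f : ℝ → ℝ` extends to a holomorphic function on the strip
`{z : |Im z| < δ}`. -/
def ExtendsHoloStrip (f : ℝ → ℝ) (δ : ℝ) : Prop :=
  ∃ F : ℂ → ℂ, DifferentiableOn ℂ F {z : ℂ | |z.im| < δ} ∧ ∀ x : ℝ, F x = (f x : ℂ)

/-- An irrational `α` is Diophantine if there are `c > 0` and `r > 1` with
`|sin(2πnα)| > c/|n|^r` for every nonzero integer `n`. -/
def IsDiophantine (α : ℝ) : Prop :=
  Irrational α ∧ ∃ c > (0 : ℝ), ∃ r > (1 : ℝ),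
    ∀ n : ℤ, n ≠ 0 → c / |(n : ℝ)| ^ r < |Real.sin (2 * Real.pi * n * α)|

open Complex ComplexConjugate MeasureTheory Set

/-- The open horizontal strip `{z : |Im z| < δ}`. -/
def horizontalStrip (δ : ℝ) : Set ℂ := {z : ℂ | |z.im| < δ}

lemma isOpen_horizontalStrip (δ : ℝ) : IsOpen (horizontalStrip δ) :=
  isOpen_lt (continuous_abs.comp continuous_im) continuous_const

lemma convex_horizontalStrip (δ : ℝ) : Convex ℝ (horizontalStrip δ) := by
  have h : horizontalStrip δ = Complex.imLm ⁻¹' Ioo (-δ) δ := by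
    ext z
    simp [horizontalStrip, abs_lt]
  rw [h]
  exact (convex_Ioo _ _).linear_preimage _

lemma horizontalStrip_mono {ε δ : ℝ} (h : ε ≤ δ) : horizontalStrip ε ⊆ horizontalStrip δ :=
  fun _ hz => lt_of_lt_of_le hz h

lemma ofReal_mem_horizontalStrip {δ : ℝ} (hδ : 0 < δ) (x : ℝ) : (x : ℂ) ∈ horizontalStrip δ := by
  simpa [horizontalStrip] using hδ

lemma ofReal_add_mul_I_mem_horizontalStrip {δ y : ℝ} (hy : |y| < δ) (x : ℝ) :
    (x : ℂ) + y * I ∈ horizontalStrip δ := by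
  simpa [horizontalStrip] using hy

lemma add_ofReal_mem_horizontalStrip {δ : ℝ} {z : ℂ} (x : ℝ) :
    z + x ∈ horizontalStrip δ ↔ z ∈ horizontalStrip δ := by
  simp [horizontalStrip]

lemma conj_mem_horizontalStrip {δ : ℝ} {z : ℂ} :
    conj z ∈ horizontalStrip δ ↔ z ∈ horizontalStrip δ := by
  simp [horizontalStrip]

lemma add_mul_I_mem_horizontalStrip {δ y : ℝ} {z : ℂ} (hz : z ∈ horizontalStrip (δ - |y|)) :
    z + y * I ∈ horizontalStrip δ := by
  have h : |z.im| < δ - |y| := hz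
  have := abs_add_le z.im y
  simp only [horizontalStrip, mem_ofPred_eq, add_im, mul_im, ofReal_re, I_im, ofReal_im, I_re]
  simp only [mul_one, mul_zero, add_zero]
  linarith

lemma DifferentiableOn.continuous_line {δ y : ℝ} {F : ℂ → ℂ}
    (hF : DifferentiableOn ℂ F (horizontalStrip δ)) (hy : |y| < δ) :
    Continuous fun x : ℝ => F (x + y * I) :=
  hF.continuousOn.comp_continuous (by fun_prop) fun x => ofReal_add_mul_I_mem_horizontalStrip hy x

lemma DifferentiableOn.continuous_ofReal {δ : ℝ} {F : ℂ → ℂ} (hδ : 0 < δ)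
    (hF : DifferentiableOn ℂ F (horizontalStrip δ)) : Continuous fun x : ℝ => F x :=
  hF.continuousOn.comp_continuous (by fun_prop) (ofReal_mem_horizontalStrip hδ)

lemma DifferentiableOn.comp_add_ofReal {δ : ℝ} {F : ℂ → ℂ}
    (hF : DifferentiableOn ℂ F (horizontalStrip δ)) (a : ℝ) :
    DifferentiableOn ℂ (fun z => F (z + a)) (horizontalStrip δ) :=
  hF.comp (by fun_prop) fun _ hz => (add_ofReal_mem_horizontalStrip a).2 hz

lemma DifferentiableOn.comp_add_mul_I {δ : ℝ} {F : ℂ → ℂ}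
    (hF : DifferentiableOn ℂ F (horizontalStrip δ)) (y : ℝ) :
    DifferentiableOn ℂ (fun z => F (z + y * I)) (horizontalStrip (δ - |y|)) :=
  hF.comp (by fun_prop) fun _ hz => add_mul_I_mem_horizontalStrip hz

/-- The Schwarz reflection of a holomorphic function is holomorphic. -/
lemma DifferentiableOn.conj_comp_conj {δ : ℝ} {F : ℂ → ℂ}
    (hF : DifferentiableOn ℂ F (horizontalStrip δ)) :
    DifferentiableOn ℂ (fun z => conj (F (conj z))) (horizontalStrip δ) := by
  intro z hz
  have h1 : DifferentiableAt ℂ F (conj z) :=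
    hF.differentiableAt ((isOpen_horizontalStrip δ).mem_nhds (conj_mem_horizontalStrip.2 hz))
  exact (differentiableAt_conj_conj_iff.2 h1).differentiableWithinAt

/-- Two holomorphic functions on a strip that agree on a horizontal line agree on the strip. -/
lemma eqOn_horizontalStrip_of_line {δ y : ℝ} {F G : ℂ → ℂ} (hy : |y| < δ)
    (hF : DifferentiableOn ℂ F (horizontalStrip δ))
    (hG : DifferentiableOn ℂ G (horizontalStrip δ))
    (h : ∀ x : ℝ, F (x + y * I) = G (x + y * I)) : EqOn F G (horizontalStrip δ) := by
  have ho := isOpen_horizontalStrip δ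
  refine AnalyticOnNhd.eqOn_of_preconnected_of_frequently_eq (z₀ := ((0 : ℝ) : ℂ) + y * I)
    (hF.analyticOnNhd ho) (hG.analyticOnNhd ho) (convex_horizontalStrip δ).isPreconnected
    (ofReal_add_mul_I_mem_horizontalStrip hy 0) ?_
  have ht : Filter.Tendsto (fun x : ℝ => (x : ℂ) + y * I) (nhdsWithin 0 {0}ᶜ)
      (nhdsWithin (((0 : ℝ) : ℂ) + y * I) {((0 : ℝ) : ℂ) + y * I}ᶜ) := by
    refine tendsto_nhdsWithin_iff.2 ⟨?_, ?_⟩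
    · have hc : Continuous fun x : ℝ => (x : ℂ) + y * I := by fun_prop
      exact (hc.tendsto 0).mono_left nhdsWithin_le_nhds
    · filter_upwards [self_mem_nhdsWithin] with x hx
      simpa using hx
  exact ht.frequently (Filter.Eventually.frequently (Filter.Eventually.of_forall h))

lemma eqOn_horizontalStrip_of_ofReal {δ : ℝ} {F G : ℂ → ℂ} (hδ : 0 < δ)
    (hF : DifferentiableOn ℂ F (horizontalStrip δ))
    (hG : DifferentiableOn ℂ G (horizontalStrip δ))
    (h : ∀ x : ℝ, F x = G x) : EqOn F G (horizontalStrip δ) :=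
  eqOn_horizontalStrip_of_line (y := 0) (by simpa using hδ) hF hG (by simpa using h)

/-- The mean of a 1-periodic holomorphic function over a horizontal line does not depend on
the line. -/
lemma integral_line_eq_integral_ofReal {δ y : ℝ} {F : ℂ → ℂ} (hy : |y| < δ)
    (hF : DifferentiableOn ℂ F (horizontalStrip δ)) (hper : Function.Periodic F 1) :
    ∫ x in (0 : ℝ)..1, F (x + y * I) = ∫ x in (0 : ℝ)..1, F x := by
  have h := integral_boundary_rect_eq_zero_of_differentiableOn F 0 (1 + y * I)
    (hF.mono fun z hz => by
      have h2 := hz.2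
      simp only [zero_im, add_im, one_im, mul_im, ofReal_re, I_im, ofReal_im, I_re, mul_one,
        mul_zero, add_zero, zero_add, mem_preimage] at h2
      have := abs_sub_left_of_mem_uIcc h2
      simp only [sub_zero] at this
      exact lt_of_le_of_lt this hy)
  have h1 : ∀ t : ℝ, F (1 + t * I) = F (t * I) := fun t => by rw [add_comm]; exact hper _
  simp only [zero_im, zero_re, add_im, one_im, mul_im, ofReal_re, I_im, ofReal_im, I_re, mul_one,
    mul_zero, add_zero, zero_add, add_re, one_re, mul_re, sub_zero, ofReal_zero, zero_mul,
    ofReal_one, h1, add_sub_cancel_right] at h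
  rw [eq_comm, ← sub_eq_zero]
  simpa using h

/-- A holomorphic periodic function without real zeros has no zeros in some thinner strip. -/
lemma exists_horizontalStrip_ne_zero {η : ℝ} {D : ℂ → ℂ} (hη : 0 < η)
    (hD : DifferentiableOn ℂ D (horizontalStrip η)) (hper : Function.Periodic D 1)
    (h0 : ∀ x : ℝ, D x ≠ 0) :
    ∃ ε > 0, ε ≤ η ∧ ∀ z ∈ horizontalStrip ε, D z ≠ 0 := by
  have hU : IsOpen (horizontalStrip η ∩ D ⁻¹' {0}ᶜ) :=
    hD.continuousOn.isOpen_inter_preimage (isOpen_horizontalStrip η) isOpen_compl_singleton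
  have hK : IsCompact (Set.image ofReal (Icc 0 1)) :=
    isCompact_Icc.image continuous_ofReal
  obtain ⟨ε, hε, hsub⟩ := hK.exists_thickening_subset_open hU (by
    rintro _ ⟨x, -, rfl⟩
    exact ⟨ofReal_mem_horizontalStrip hη x, h0 x⟩)
  refine ⟨min ε η, lt_min hε hη, min_le_right _ _, fun z hz => ?_⟩
  have hz' : |z.im| < ε := lt_of_lt_of_le hz (min_le_left _ _)
  have hmem : z - (⌊z.re⌋ : ℂ) ∈ Metric.thickening ε (Set.image ofReal (Icc 0 1)) := by
    rw [Metric.mem_thickening_iff]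
    refine ⟨((Int.fract z.re : ℝ) : ℂ),
      ⟨_, ⟨Int.fract_nonneg _, (Int.fract_lt_one _).le⟩, rfl⟩, ?_⟩
    have : z - (⌊z.re⌋ : ℂ) - ((Int.fract z.re : ℝ) : ℂ) = z.im * I := by
      rw [← Int.self_sub_floor]
      apply Complex.ext <;> simp
    rw [dist_eq_norm, this]
    simpa using hz'
  have := (hsub hmem).2
  have hp := hper.sub_zsmul_eq (x := z) ⌊z.re⌋
  simp only [zsmul_eq_mul, mul_one] at hp
  simpa [hp] using this

/-- A function with periods `1` and an irrational number is constant on a dense set. -/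
lemma exists_dense_forall_eq {β : Type*} {α : ℝ} (hα : Irrational α) {h : ℝ → β}
    (h1 : Function.Periodic h 1) (h2 : Function.Periodic h α) :
    ∃ s : Set ℝ, Dense s ∧ ∀ x ∈ s, h x = h 0 := by
  refine ⟨AddSubgroup.closure {α, 1},
    dense_addSubgroupClosure_pair_iff.2 (by simpa using hα), fun x hx => ?_⟩
  obtain ⟨m, n, rfl⟩ := AddSubgroup.mem_closure_pair.1 hx
  rw [(h1.zsmul n) _, ← zero_add (m • α), (h2.zsmul m) _]

lemma summable_nat_pow_mul_exp_neg_natAbs (k : ℕ) {s : ℝ} (hs : 0 < s) :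
    Summable fun n : ℤ => |(n : ℝ)| ^ k * Real.exp (-s * |(n : ℝ)|) := by
  refine Summable.of_nat_of_neg ?_ ?_ <;>
    simpa using Real.summable_pow_mul_exp_neg_nat_mul k hs

/-- The Fourier coefficients of a 1-periodic function on the real line. -/
noncomputable def lineFourierCoeff (b : ℂ → ℂ) (n : ℤ) : ℂ :=
  ∫ x in (0 : ℝ)..1, exp (2 * Real.pi * I * ((-n : ℤ) : ℂ) * x) * b x

lemma periodic_exp_int (n : ℤ) :
    Function.Periodic (fun z : ℂ => exp (2 * Real.pi * I * (n : ℂ) * z)) 1 := by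
  intro z
  simp only
  rw [show 2 * (Real.pi : ℂ) * I * n * (z + 1) = 2 * Real.pi * I * n * z + n * (2 * Real.pi * I) by
    ring, exp_add, exp_int_mul_two_pi_mul_I, mul_one]

lemma norm_exp_int (n : ℤ) (z : ℂ) :
    ‖exp (2 * Real.pi * I * (n : ℂ) * z)‖ = Real.exp (-(2 * Real.pi * n * z.im)) := by
  rw [norm_exp]
  congr 1
  simp [mul_re, mul_im]

lemma exists_norm_lineFourierCoeff_le {η ρ : ℝ} {b : ℂ → ℂ} (hρ0 : 0 < ρ) (hρ : ρ < η)
    (hb : DifferentiableOn ℂ b (horizontalStrip η)) (hper : Function.Periodic b 1) :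
    ∃ M : ℝ, 0 ≤ M ∧ ∀ n : ℤ,
      ‖lineFourierCoeff b n‖ ≤ M * Real.exp (-(2 * Real.pi * ρ * |(n : ℝ)|)) := by
  have hbd : ∀ y : ℝ, |y| < η → ∃ M : ℝ, ∀ x ∈ Icc (0 : ℝ) 1, ‖b (x + y * I)‖ ≤ M := fun y hy =>
    isCompact_Icc.exists_bound_of_continuousOn (hb.continuous_line hy).continuousOn
  obtain ⟨M₁, hM₁⟩ := hbd ρ (by rwa [abs_of_pos hρ0])
  obtain ⟨M₂, hM₂⟩ := hbd (-ρ) (by rwa [abs_neg, abs_of_pos hρ0])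
  have key : ∀ (y M : ℝ), |y| < η → (∀ x ∈ Icc (0 : ℝ) 1, ‖b (x + y * I)‖ ≤ M) → ∀ n : ℤ,
      ‖lineFourierCoeff b n‖ ≤ Real.exp (2 * Real.pi * n * y) * M := by
    intro y M hy hM n
    have hshift := integral_line_eq_integral_ofReal
      (F := fun z => exp (2 * Real.pi * I * ((-n : ℤ) : ℂ) * z) * b z) hy
      (DifferentiableOn.mul (by fun_prop) hb) ((periodic_exp_int (-n)).mul hper)
    rw [lineFourierCoeff, ← hshift]
    have := intervalIntegral.norm_integral_le_of_norm_le_const (a := 0) (b := 1)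
      (f := fun x : ℝ => exp (2 * Real.pi * I * ((-n : ℤ) : ℂ) * (x + y * I)) * b (x + y * I))
      (C := Real.exp (2 * Real.pi * n * y) * M) (fun x hx => by
        rw [uIoc_of_le zero_le_one] at hx
        rw [norm_mul, norm_exp_int]
        have h2 := hM x ⟨hx.1.le, hx.2⟩
        have h3 : -(2 * Real.pi * ((-n : ℤ) : ℝ) * ((x : ℂ) + y * I).im)
            = 2 * Real.pi * n * y := by simp
        rw [h3]
        gcongr)
    simpa using this
  refine ⟨max (max M₁ M₂) 0, le_max_right _ _, fun n => ?_⟩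
  rcases le_total 0 (n : ℝ) with hn | hn
  · refine (key (-ρ) M₂ (by rwa [abs_neg, abs_of_pos hρ0]) hM₂ n).trans ?_
    rw [abs_of_nonneg hn, mul_comm,
      show 2 * Real.pi * n * -ρ = -(2 * Real.pi * ρ * n) by ring]
    gcongr
    exact (le_max_right _ _).trans (le_max_left _ _)
  · refine (key ρ M₁ (by rwa [abs_of_pos hρ0]) hM₁ n).trans ?_
    rw [abs_of_nonpos hn, mul_comm,
      show 2 * Real.pi * n * ρ = -(2 * Real.pi * ρ * -n) by ring]
    gcongr
    exact (le_max_left _ _).trans (le_max_left _ _)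

/-- Fourier inversion on the real line. -/
lemma hasSum_lineFourierCoeff {b : ℂ → ℂ} (hc : Continuous fun x : ℝ => b x)
    (hper : Function.Periodic b 1) (hs : Summable (lineFourierCoeff b)) (x : ℝ) :
    HasSum (fun n : ℤ => lineFourierCoeff b n * exp (2 * Real.pi * I * n * x)) (b x) := by
  have hp : Function.Periodic (fun x : ℝ => b x) 1 := fun x => by
    simpa using hper x
  let f : C(AddCircle (1 : ℝ), ℂ) := ⟨hp.lift, hc.quotient_lift _⟩
  have hf : ∀ x : ℝ, f (x : AddCircle (1 : ℝ)) = b x := fun x => hp.lift_coe x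
  have : Fact ((0 : ℝ) < 1) := ⟨one_pos⟩
  have hcoeff : fourierCoeff f = lineFourierCoeff b := by
    funext n
    rw [fourierCoeff_eq_intervalIntegral _ n 0, lineFourierCoeff]
    simp only [hf, fourier_coe_apply]
    simp
  have := has_pointwise_sum_fourier_series_of_summable (f := f) (by rwa [hcoeff])
    (x : AddCircle (1 : ℝ))
  simpa [hcoeff, hf, fourier_coe_apply] using this

/-- The small divisors of a Diophantine number are polynomially bounded from below. -/
lemma IsDiophantine.exists_norm_inv_exp_sub_one_le {α : ℝ} (hα : IsDiophantine α) :
    ∃ C : ℝ, 0 ≤ C ∧ ∃ k : ℕ, ∀ n : ℤ, n ≠ 0 →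
      exp (2 * Real.pi * I * n * α) - 1 ≠ 0 ∧
      ‖(exp (2 * Real.pi * I * n * α) - 1)⁻¹‖ ≤ C * |(n : ℝ)| ^ k := by
  obtain ⟨-, c, hc, r, hr, h⟩ := hα
  refine ⟨c⁻¹, inv_nonneg.2 hc.le, ⌈r⌉₊, fun n hn => ?_⟩
  have hn1 : 1 ≤ |(n : ℝ)| := by exact_mod_cast Int.one_le_abs hn
  have hpos : 0 < |(n : ℝ)| ^ r := Real.rpow_pos_of_pos (by linarith) _
  have hsin : |Real.sin (2 * Real.pi * n * α)| ≤ ‖exp (2 * Real.pi * I * n * α) - 1‖ := by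
    have him : (exp (2 * Real.pi * I * n * α) - 1).im = Real.sin (2 * Real.pi * n * α) := by
      rw [show 2 * (Real.pi : ℂ) * I * n * α = ((2 * Real.pi * n * α : ℝ) : ℂ) * I by
        push_cast; ring, sub_im, exp_ofReal_mul_I_im]
      simp
    rw [← him]
    exact abs_im_le_norm _
  have hlt : c / |(n : ℝ)| ^ r < ‖exp (2 * Real.pi * I * n * α) - 1‖ := (h n hn).trans_le hsin
  have hq : 0 < c / |(n : ℝ)| ^ r := div_pos hc hpos
  refine ⟨norm_pos_iff.1 (hq.trans hlt), ?_⟩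
  rw [norm_inv]
  calc ‖exp (2 * Real.pi * I * n * α) - 1‖⁻¹ ≤ (c / |(n : ℝ)| ^ r)⁻¹ := by gcongr
    _ = c⁻¹ * |(n : ℝ)| ^ r := by rw [inv_div, div_eq_inv_mul]
    _ ≤ c⁻¹ * |(n : ℝ)| ^ ⌈r⌉₊ := by
      rw [← Real.rpow_natCast]
      gcongr
      exact Nat.le_ceil r

/-- The cohomological equation over a Diophantine rotation has a holomorphic solution, on a
thinner strip. -/
lemma exists_cohomological_solution {α η : ℝ} {b : ℂ → ℂ} (hα : IsDiophantine α) (hη : 0 < η)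
    (hb : DifferentiableOn ℂ b (horizontalStrip η)) (hper : Function.Periodic b 1) :
    ∃ ε > 0, ε ≤ η ∧ ∃ (c : ℂ) (φ : ℂ → ℂ), DifferentiableOn ℂ φ (horizontalStrip ε) ∧
      Function.Periodic φ 1 ∧ ∀ z ∈ horizontalStrip ε, φ (z + α) - φ z = b z - c := by
  obtain ⟨M, hM0, hM⟩ := exists_norm_lineFourierCoeff_le (ρ := η / 2) (by linarith)
    (by linarith) hb hper
  obtain ⟨C, hC0, k, hC⟩ := hα.exists_norm_inv_exp_sub_one_le
  have hπ := Real.pi_pos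
  set β := lineFourierCoeff b with hβ
  have hsβ : Summable β := by
    have h := (summable_nat_pow_mul_exp_neg_natAbs 0 (s := 2 * Real.pi * (η / 2))
      (by positivity)).mul_left M
    refine Summable.of_norm_bounded h fun n => ?_
    simpa [neg_mul] using hM n
  set φc : ℤ → ℂ := fun n =>
    if n = 0 then 0 else (exp (2 * Real.pi * I * n * α) - 1)⁻¹ * β n with hφc
  have hterm : ∀ n : ℤ, ∀ z ∈ horizontalStrip (η / 4), ‖φc n * exp (2 * Real.pi * I * n * z)‖ ≤
      C * M * (|(n : ℝ)| ^ k * Real.exp (-(2 * Real.pi * (η / 4)) * |(n : ℝ)|)) := by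
    intro n z hz
    have hz' : |z.im| < η / 4 := hz
    by_cases hn : n = 0
    · simp only [hφc, hn, if_true, zero_mul, norm_zero]
      positivity
    · simp only [hφc, hn, if_false]
      rw [norm_mul, norm_mul, norm_exp_int]
      have h1 : -(2 * Real.pi * n * z.im) ≤ 2 * Real.pi * (η / 4) * |(n : ℝ)| := by
        have h2 : -(n * z.im) ≤ |(n : ℝ)| * (η / 4) := by
          refine (neg_le_abs _).trans ?_
          rw [abs_mul]
          gcongr
        nlinarith
      calc _ ≤ C * |(n : ℝ)| ^ k * (M * Real.exp (-(2 * Real.pi * (η / 2) * |(n : ℝ)|))) *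
            Real.exp (2 * Real.pi * (η / 4) * |(n : ℝ)|) := by
            gcongr
            · exact (hC n hn).2
            · exact hM n
        _ = C * M * (|(n : ℝ)| ^ k * (Real.exp (-(2 * Real.pi * (η / 2) * |(n : ℝ)|)) *
            Real.exp (2 * Real.pi * (η / 4) * |(n : ℝ)|))) := by ring
        _ = _ := by
            rw [← Real.exp_add]
            ring_nf
  have hsum := (summable_nat_pow_mul_exp_neg_natAbs k (s := 2 * Real.pi * (η / 4))
    (by positivity)).mul_left (C * M)
  have hdiff : DifferentiableOn ℂ (fun z => ∑' n : ℤ, φc n * exp (2 * Real.pi * I * n * z))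
      (horizontalStrip (η / 4)) :=
    differentiableOn_tsum_of_summable_norm hsum (fun n => by fun_prop)
      (isOpen_horizontalStrip _) hterm
  have hle : η / 4 ≤ η := by linarith
  have hη4 : 0 < η / 4 := by linarith
  refine ⟨η / 4, hη4, hle, β 0, _, hdiff, fun z => ?_, ?_⟩
  · exact tsum_congr fun n => congrArg (φc n * ·) (periodic_exp_int n z)
  · refine eqOn_horizontalStrip_of_ofReal hη4 ((hdiff.comp_add_ofReal α).sub hdiff)
      ((hb.mono (horizontalStrip_mono hle)).sub_const _) fun x => ?_
    have hS : ∀ t : ℝ, Summable fun n : ℤ => φc n * exp (2 * Real.pi * I * n * t) := fun t =>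
      Summable.of_norm_bounded hsum fun n => hterm n t (ofReal_mem_horizontalStrip hη4 t)
    have hcast : (x : ℂ) + α = ((x + α : ℝ) : ℂ) := by push_cast; rfl
    have hF := hasSum_lineFourierCoeff (hb.continuous_ofReal hη) hper hsβ x
    have h0 : HasSum (fun n : ℤ => if n = 0 then β 0 else 0) (β 0) := hasSum_ite_eq 0 (β 0)
    have hR := hF.sub h0
    have hL := (hS (x + α)).hasSum.sub (hS x).hasSum
    simp only [hcast]
    refine hL.unique ?_
    convert hR using 2 with n
    by_cases hn : n = 0
    · simp [hφc, hn, hβ]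
    · have hne := (hC n hn).1
      simp only [hφc, hn, if_false, sub_zero, ofReal_add, mul_add, exp_add]
      field_simp
      rfl

/-- A normalized complement of an invariant section that puts the cocycle in unipotent form is
unique on a given horizontal line. -/
lemma normalized_complement_unique {α : ℝ} (hα : Irrational α)
    {p q r s f g u w u' w' : ℝ → ℂ} {c c' : ℂ}
    (hfc : Continuous f) (hgc : Continuous g) (huc : Continuous u) (hwc : Continuous w)
    (huc' : Continuous u') (hwc' : Continuous w')
    (hup : Function.Periodic u 1) (hwp : Function.Periodic w 1)
    (hup' : Function.Periodic u' 1) (hwp' : Function.Periodic w' 1)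
    (hne : ∀ x, f x ≠ 0 ∨ g x ≠ 0)
    (hf : ∀ x, f (x + α) = p x * f x + q x * g x)
    (hg : ∀ x, g (x + α) = r x * f x + s x * g x)
    (hdet : ∀ x, f x * w x - g x * u x = 1) (hdet' : ∀ x, f x * w' x - g x * u' x = 1)
    (hu : ∀ x, p x * u x + q x * w x = c * f (x + α) + u (x + α))
    (hw : ∀ x, r x * u x + s x * w x = c * g (x + α) + w (x + α))
    (hu' : ∀ x, p x * u' x + q x * w' x = c' * f (x + α) + u' (x + α))
    (hw' : ∀ x, r x * u' x + s x * w' x = c' * g (x + α) + w' (x + α))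
    (hκ : ∫ x in (0 : ℝ)..1, (f x * f x + g x * g x) ≠ 0)
    (hn : ∫ x in (0 : ℝ)..1, (f x * u x + g x * w x) = 0)
    (hn' : ∫ x in (0 : ℝ)..1, (f x * u' x + g x * w' x) = 0) : u = u' ∧ w = w' := by
  set h : ℝ → ℂ := fun x => w x * u' x * (-1) + u x * w' x with hh
  have hhu : ∀ x, u x - u' x = h x * f x := fun x => by
    simp only [hh]
    linear_combination (-u x) * hdet' x + u' x * hdet x
  have hhw : ∀ x, w x - w' x = h x * g x := fun x => by
    simp only [hh]
    linear_combination (-w x) * hdet' x + w' x * hdet x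
  have hc : Continuous h := by fun_prop
  have hp : Function.Periodic h 1 := fun x => by
    simp only [hh, hup x, hwp x, hup' x, hwp' x]
  have hcoh : ∀ x, h x = (c - c') + h (x + α) := fun x => by
    have e1 : (h x - ((c - c') + h (x + α))) * f (x + α) = 0 := by
      linear_combination hu x - hu' x + h x * hf x - p x * hhu x - q x * hhw x + hhu (x + α)
    have e2 : (h x - ((c - c') + h (x + α))) * g (x + α) = 0 := by
      linear_combination hw x - hw' x + h x * hg x - r x * hhu x - s x * hhw x + hhw (x + α)
    rcases hne (x + α) with h0 | h0
    · exact sub_eq_zero.1 ((mul_eq_zero.1 e1).resolve_right h0)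
    · exact sub_eq_zero.1 ((mul_eq_zero.1 e2).resolve_right h0)
  have hcc : c - c' = 0 := by
    have i1 : ∫ x in (0 : ℝ)..1, h x = ∫ x in (0 : ℝ)..1, ((c - c') + h (x + α)) := by
      congr 1
      exact funext hcoh
    have hi : IntervalIntegrable (fun x => h (x + α)) volume 0 1 :=
      (by fun_prop : Continuous fun x => h (x + α)).intervalIntegrable _ _
    rw [intervalIntegral.integral_add (by simp) hi, intervalIntegral.integral_comp_add_right,
      zero_add, add_comm (1 : ℝ), hp.intervalIntegral_add_eq α 0, zero_add] at i1
    simpa using i1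
  obtain ⟨S, hS, hS0⟩ := exists_dense_forall_eq hα hp
    fun x => by rw [hcoh x, hcc, zero_add]
  have hconst : ∀ x, h x = h 0 :=
    congrFun (hc.ext_on hS continuous_const hS0)
  have h0 : h 0 = 0 := by
    have i1 : ∫ x in (0 : ℝ)..1, h 0 * (f x * f x + g x * g x) = 0 := by
      have : (fun x => h 0 * (f x * f x + g x * g x)) =
          fun x => (f x * u x + g x * w x) - (f x * u' x + g x * w' x) := by
        funext x
        rw [← hconst x]
        linear_combination (-f x) * hhu x - g x * hhw x
      rw [this, intervalIntegral.integral_sub, hn, hn', sub_zero]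
      · exact (by fun_prop : Continuous fun x => f x * u x + g x * w x).intervalIntegrable _ _
      · exact (by fun_prop : Continuous fun x => f x * u' x + g x * w' x).intervalIntegrable _ _
    rw [intervalIntegral.integral_const_mul] at i1
    exact (mul_eq_zero.1 i1).resolve_right hκ
  constructor
  · funext x
    have := hhu x
    rwa [hconst x, h0, zero_mul, sub_eq_zero] at this
  · funext x
    have := hhw x
    rwa [hconst x, h0, zero_mul, sub_eq_zero] at this

/-- Near the real line, an invariant section of a Diophantine cocycle has a holomorphic
complement that puts the cocycle in unipotent form. -/
lemma exists_complement_near_line {α η : ℝ} (hα : IsDiophantine α) (hη : 0 < η)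
    {p q r s f g : ℂ → ℂ}
    (hpd : DifferentiableOn ℂ p (horizontalStrip η))
    (hqd : DifferentiableOn ℂ q (horizontalStrip η))
    (hrd : DifferentiableOn ℂ r (horizontalStrip η))
    (hsd : DifferentiableOn ℂ s (horizontalStrip η))
    (hfd : DifferentiableOn ℂ f (horizontalStrip η))
    (hgd : DifferentiableOn ℂ g (horizontalStrip η))
    (hpp : Function.Periodic p 1) (hqp : Function.Periodic q 1)
    (hrp : Function.Periodic r 1) (hsp : Function.Periodic s 1)
    (hfp : Function.Periodic f 1) (hgp : Function.Periodic g 1)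
    (hdet : ∀ z ∈ horizontalStrip η, p z * s z - q z * r z = 1)
    (hf : ∀ z ∈ horizontalStrip η, f (z + α) = p z * f z + q z * g z)
    (hg : ∀ z ∈ horizontalStrip η, g (z + α) = r z * f z + s z * g z)
    (hne : ∀ x : ℝ, f x ≠ 0 ∨ g x ≠ 0) :
    ∃ ε > 0, ε ≤ η ∧ ∃ (c : ℂ) (u w : ℂ → ℂ),
      DifferentiableOn ℂ u (horizontalStrip ε) ∧ DifferentiableOn ℂ w (horizontalStrip ε) ∧
      Function.Periodic u 1 ∧ Function.Periodic w 1 ∧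
      (∀ z ∈ horizontalStrip ε, f z * w z - g z * u z = 1) ∧
      (∀ z ∈ horizontalStrip ε, p z * u z + q z * w z = c * f (z + α) + u (z + α)) ∧
      (∀ z ∈ horizontalStrip ε, r z * u z + s z * w z = c * g (z + α) + w (z + α)) := by
  set D : ℂ → ℂ := fun z => f z * conj (f (conj z)) + g z * conj (g (conj z)) with hD
  have hDd : DifferentiableOn ℂ D (horizontalStrip η) :=
    (hfd.mul hfd.conj_comp_conj).add (hgd.mul hgd.conj_comp_conj)
  have hconj : ∀ {F : ℂ → ℂ}, Function.Periodic F 1 →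
      Function.Periodic (fun z => conj (F (conj z))) 1 := fun hF z => by
    simp only [map_add, map_one, hF (conj z)]
  have hDp : Function.Periodic D 1 := (hfp.mul (hconj hfp)).add (hgp.mul (hconj hgp))
  have hD0 : ∀ x : ℝ, D x ≠ 0 := fun x => by
    have e : D x = ((normSq (f x) + normSq (g x) : ℝ) : ℂ) := by
      simp only [hD, conj_ofReal, mul_conj]
      push_cast
      rfl
    rw [e, ofReal_ne_zero]
    rcases hne x with h | h
    · have := normSq_pos.2 h
      have := normSq_nonneg (g x)
      positivity
    · have := normSq_pos.2 h
      have := normSq_nonneg (f x)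
      positivity
  obtain ⟨ε₁, hε₁, hle₁, hD1⟩ := exists_horizontalStrip_ne_zero hη hDd hDp hD0
  have hm := horizontalStrip_mono hle₁
  set u₀ : ℂ → ℂ := fun z => -conj (g (conj z)) / D z with hu₀
  set w₀ : ℂ → ℂ := fun z => conj (f (conj z)) / D z with hw₀
  have hu₀d : DifferentiableOn ℂ u₀ (horizontalStrip ε₁) :=
    (hgd.conj_comp_conj.neg.mono hm).div (hDd.mono hm) hD1
  have hw₀d : DifferentiableOn ℂ w₀ (horizontalStrip ε₁) :=
    (hfd.conj_comp_conj.mono hm).div (hDd.mono hm) hD1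
  have hu₀p : Function.Periodic u₀ 1 := fun z => by
    simp only [hu₀, hDp z, map_add, map_one, hgp (conj z)]
  have hw₀p : Function.Periodic w₀ 1 := (hconj hfp).div hDp
  have hdet₀ : ∀ z ∈ horizontalStrip ε₁, f z * w₀ z - g z * u₀ z = 1 := fun z hz => by
    have := hD1 z hz
    simp only [hu₀, hw₀]
    field_simp
    simp only [hD]
    ring
  set b : ℂ → ℂ := fun z => (p z * u₀ z + q z * w₀ z) * w₀ (z + α) -
    (r z * u₀ z + s z * w₀ z) * u₀ (z + α) with hb
  have hshift : ∀ {F : ℂ → ℂ}, Function.Periodic F 1 →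
      Function.Periodic (fun z => F (z + α)) 1 := fun hF z => by
    simp only [add_right_comm z 1, hF (z + α)]
  have hbd : DifferentiableOn ℂ b (horizontalStrip ε₁) :=
    ((((hpd.mono hm).mul hu₀d).add ((hqd.mono hm).mul hw₀d)).mul (hw₀d.comp_add_ofReal α)).sub
      ((((hrd.mono hm).mul hu₀d).add ((hsd.mono hm).mul hw₀d)).mul (hu₀d.comp_add_ofReal α))
  have hbp : Function.Periodic b 1 :=
    (((hpp.mul hu₀p).add (hqp.mul hw₀p)).mul (hshift hw₀p)).sub
      (((hrp.mul hu₀p).add (hsp.mul hw₀p)).mul (hshift hu₀p))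
  obtain ⟨ε, hε, hle, c, φ, hφd, hφp, hφ⟩ := exists_cohomological_solution hα hε₁ hbd hbp
  have hm' := horizontalStrip_mono hle
  have hmη := horizontalStrip_mono (hle.trans hle₁)
  refine ⟨ε, hε, hle.trans hle₁, c, fun z => u₀ z + φ z * f z, fun z => w₀ z + φ z * g z,
    (hu₀d.mono hm').add (hφd.mul (hfd.mono hmη)), (hw₀d.mono hm').add (hφd.mul (hgd.mono hmη)),
    hu₀p.add (hφp.mul hfp), hw₀p.add (hφp.mul hgp), fun z hz => ?_, fun z hz => ?_,
    fun z hz => ?_⟩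
  · linear_combination hdet₀ z (hm' hz)
  all_goals
    have hd := hdet₀ z (hm' hz)
    have hd' := hdet₀ (z + α) ((add_ofReal_mem_horizontalStrip α).2 (hm' hz))
    have hfz := hf z (hmη hz)
    have hgz := hg z (hmη hz)
    have hA := hdet z (hmη hz)
    have hφz := hφ z hz
    have hX : f (z + α) * (r z * u₀ z + s z * w₀ z) -
        g (z + α) * (p z * u₀ z + q z * w₀ z) = 1 := by
      rw [hfz, hgz]
      linear_combination (p z * s z - q z * r z) * hd + hA
    simp only [hb] at hφz
  · linear_combination (-(p z * u₀ z + q z * w₀ z)) * hd' + u₀ (z + α) * hX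
      - φ z * hfz - f (z + α) * hφz
  · linear_combination (-(r z * u₀ z + s z * w₀ z)) * hd' + w₀ (z + α) * hX
      - φ z * hgz - g (z + α) * hφz

/-- An invariant section of a cocycle over an irrational rotation has no zeros, unless it vanishes
identically. -/
lemma invariant_section_ne_zero {α δ : ℝ} (hα : Irrational α) {p q r s f g : ℂ → ℂ}
    (hfd : DifferentiableOn ℂ f (horizontalStrip δ))
    (hgd : DifferentiableOn ℂ g (horizontalStrip δ))
    (hfp : Function.Periodic f 1) (hgp : Function.Periodic g 1)
    (hdet : ∀ z ∈ horizontalStrip δ, p z * s z - q z * r z = 1)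
    (hf : ∀ z ∈ horizontalStrip δ, f (z + α) = p z * f z + q z * g z)
    (hg : ∀ z ∈ horizontalStrip δ, g (z + α) = r z * f z + s z * g z)
    (h0 : f 0 ≠ 0 ∨ g 0 ≠ 0) : ∀ z ∈ horizontalStrip δ, f z ≠ 0 ∨ g z ≠ 0 := by
  intro z hz
  by_contra! hz0
  set P : ℝ → Prop := fun x => f (z + x) = 0 ∧ g (z + x) = 0 with hP
  have h1 : Function.Periodic P 1 := fun x => by
    simp only [hP, ofReal_add, ofReal_one, ← add_assoc, hfp (z + x), hgp (z + x)]
  have h2 : Function.Periodic P α := fun x => by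
    have hzx : z + x ∈ horizontalStrip δ := (add_ofReal_mem_horizontalStrip x).2 hz
    have e1 := hf _ hzx
    have e2 := hg _ hzx
    have e3 := hdet _ hzx
    simp only [hP, ofReal_add, ← add_assoc]
    refine propext ⟨fun ⟨a, b⟩ => ⟨?_, ?_⟩, fun ⟨a, b⟩ => ⟨?_, ?_⟩⟩
    · rw [a] at e1
      rw [b] at e2
      linear_combination (-f (z + x)) * e3 - s (z + x) * e1 + q (z + x) * e2
    · rw [a] at e1
      rw [b] at e2
      linear_combination (-g (z + x)) * e3 + r (z + x) * e1 - p (z + x) * e2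
    · rw [e1, a, b]
      ring
    · rw [e2, a, b]
      ring
  obtain ⟨S, hS, hS0⟩ := exists_dense_forall_eq hα h1 h2
  have hP0 : P 0 := by simpa [hP] using hz0
  have hc : ∀ {F : ℂ → ℂ}, DifferentiableOn ℂ F (horizontalStrip δ) →
      Continuous fun x : ℝ => F (z + x) := fun hF =>
    hF.continuousOn.comp_continuous (by fun_prop)
      fun x => (add_ofReal_mem_horizontalStrip x).2 hz
  have hall : ∀ x, P x := fun x => hS.induction (P := P) (fun x hx => by rw [hS0 x hx]; exact hP0)
    ((isClosed_eq (hc hfd) continuous_const).inter (isClosed_eq (hc hgd) continuous_const)) x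
  have hline : ∀ x : ℝ, (x : ℂ) + z.im * I = z + ((x - z.re : ℝ) : ℂ) := fun x => by
    apply Complex.ext <;> simp
  have hδ : 0 < δ := lt_of_le_of_lt (abs_nonneg _) hz
  have hmem : (0 : ℂ) ∈ horizontalStrip δ := by simpa using ofReal_mem_horizontalStrip hδ 0
  rcases h0 with h | h
  · exact h (eqOn_horizontalStrip_of_line (G := fun _ => 0) (y := z.im) hz hfd (by fun_prop)
      (fun x => by rw [hline x]; exact (hall _).1) hmem)
  · exact h (eqOn_horizontalStrip_of_line (G := fun _ => 0) (y := z.im) hz hgd (by fun_prop)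
      (fun x => by rw [hline x]; exact (hall _).2) hmem)

/-- The complement of `exists_complement_near_line` can be normalized by adding a multiple of the
invariant section. -/
lemma exists_normalized_complement_near_line {α η : ℝ} (hα : IsDiophantine α) (hη : 0 < η)
    {p q r s f g : ℂ → ℂ}
    (hpd : DifferentiableOn ℂ p (horizontalStrip η))
    (hqd : DifferentiableOn ℂ q (horizontalStrip η))
    (hrd : DifferentiableOn ℂ r (horizontalStrip η))
    (hsd : DifferentiableOn ℂ s (horizontalStrip η))
    (hfd : DifferentiableOn ℂ f (horizontalStrip η))
    (hgd : DifferentiableOn ℂ g (horizontalStrip η))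
    (hpp : Function.Periodic p 1) (hqp : Function.Periodic q 1)
    (hrp : Function.Periodic r 1) (hsp : Function.Periodic s 1)
    (hfp : Function.Periodic f 1) (hgp : Function.Periodic g 1)
    (hdet : ∀ z ∈ horizontalStrip η, p z * s z - q z * r z = 1)
    (hf : ∀ z ∈ horizontalStrip η, f (z + α) = p z * f z + q z * g z)
    (hg : ∀ z ∈ horizontalStrip η, g (z + α) = r z * f z + s z * g z)
    (hne : ∀ x : ℝ, f x ≠ 0 ∨ g x ≠ 0)
    (hκ : ∫ x in (0 : ℝ)..1, (f x * f x + g x * g x) ≠ 0) :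
    ∃ ε > 0, ε ≤ η ∧ ∃ (c : ℂ) (u w : ℂ → ℂ),
      DifferentiableOn ℂ u (horizontalStrip ε) ∧ DifferentiableOn ℂ w (horizontalStrip ε) ∧
      Function.Periodic u 1 ∧ Function.Periodic w 1 ∧
      (∀ z ∈ horizontalStrip ε, f z * w z - g z * u z = 1) ∧
      (∀ z ∈ horizontalStrip ε, p z * u z + q z * w z = c * f (z + α) + u (z + α)) ∧
      (∀ z ∈ horizontalStrip ε, r z * u z + s z * w z = c * g (z + α) + w (z + α)) ∧
      ∀ t : ℝ, |t| < ε →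
        ∫ x in (0 : ℝ)..1, (f (x + t * I) * u (x + t * I) + g (x + t * I) * w (x + t * I)) = 0 := by
  obtain ⟨ε, hε, hle, c, u, w, hud, hwd, hup, hwp, hd, hu, hw⟩ :=
    exists_complement_near_line hα hη hpd hqd hrd hsd hfd hgd hpp hqp hrp hsp hfp hgp hdet hf hg hne
  have hm := horizontalStrip_mono hle
  set κ := ∫ x in (0 : ℝ)..1, (f x * f x + g x * g x) with hκdef
  set m := ∫ x in (0 : ℝ)..1, (f x * u x + g x * w x) with hmdef
  have hud' : DifferentiableOn ℂ (fun z => u z - m / κ * f z) (horizontalStrip ε) :=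
    hud.sub ((hfd.mono hm).const_mul _)
  have hwd' : DifferentiableOn ℂ (fun z => w z - m / κ * g z) (horizontalStrip ε) :=
    hwd.sub ((hgd.mono hm).const_mul _)
  have hup' : Function.Periodic (fun z => u z - m / κ * f z) 1 := fun z => by
    simp only [hup z, hfp z]
  have hwp' : Function.Periodic (fun z => w z - m / κ * g z) 1 := fun z => by
    simp only [hwp z, hgp z]
  refine ⟨ε, hε, hle, c, _, _, hud', hwd', hup', hwp', fun z hz => ?_, fun z hz => ?_,
    fun z hz => ?_, fun t ht => ?_⟩
  · linear_combination hd z hz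
  · linear_combination hu z hz + m / κ * hf z (hm hz)
  · linear_combination hw z hz + m / κ * hg z (hm hz)
  · have := integral_line_eq_integral_ofReal
      (F := fun z => f z * (u z - m / κ * f z) + g z * (w z - m / κ * g z)) ht
      (((hfd.mono hm).mul hud').add ((hgd.mono hm).mul hwd')) ((hfp.mul hup').add (hgp.mul hwp'))
    rw [this]
    have e : (fun x : ℝ => f x * (u x - m / κ * f x) + g x * (w x - m / κ * g x)) =
        fun x : ℝ => (f x * u x + g x * w x) - m / κ * (f x * f x + g x * g x) := by
      funext x
      ring
    have c1 := hfd.continuous_ofReal hη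
    have c2 := hgd.continuous_ofReal hη
    have c3 := hud.continuous_ofReal hε
    have c4 := hwd.continuous_ofReal hε
    have i1 : IntervalIntegrable (fun x : ℝ => f x * u x + g x * w x) volume 0 1 :=
      ((c1.mul c3).add (c2.mul c4)).intervalIntegrable _ _
    have i2 : IntervalIntegrable (fun x : ℝ => m / κ * (f x * f x + g x * g x)) volume 0 1 :=
      (((c1.mul c1).add (c2.mul c2)).const_mul _).intervalIntegrable _ _
    rw [e, intervalIntegral.integral_sub i1 i2, intervalIntegral.integral_const_mul,
      ← hκdef, ← hmdef]
    field_simp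
    ring

/-- A nowhere vanishing invariant section of a Diophantine cocycle has a holomorphic complement
on the whole strip that puts the cocycle in unipotent form. -/
lemma exists_complement {α δ : ℝ} (hα : IsDiophantine α) (hδ : 0 < δ)
    {p q r s f g : ℂ → ℂ}
    (hpd : DifferentiableOn ℂ p (horizontalStrip δ))
    (hqd : DifferentiableOn ℂ q (horizontalStrip δ))
    (hrd : DifferentiableOn ℂ r (horizontalStrip δ))
    (hsd : DifferentiableOn ℂ s (horizontalStrip δ))
    (hfd : DifferentiableOn ℂ f (horizontalStrip δ))
    (hgd : DifferentiableOn ℂ g (horizontalStrip δ))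
    (hpp : Function.Periodic p 1) (hqp : Function.Periodic q 1)
    (hrp : Function.Periodic r 1) (hsp : Function.Periodic s 1)
    (hfp : Function.Periodic f 1) (hgp : Function.Periodic g 1)
    (hdet : ∀ z ∈ horizontalStrip δ, p z * s z - q z * r z = 1)
    (hf : ∀ z ∈ horizontalStrip δ, f (z + α) = p z * f z + q z * g z)
    (hg : ∀ z ∈ horizontalStrip δ, g (z + α) = r z * f z + s z * g z)
    (hne : ∀ z ∈ horizontalStrip δ, f z ≠ 0 ∨ g z ≠ 0)
    (hκ : ∫ x in (0 : ℝ)..1, (f x * f x + g x * g x) ≠ 0) :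
    ∃ (c : ℂ) (u w : ℂ → ℂ),
      DifferentiableOn ℂ u (horizontalStrip δ) ∧ DifferentiableOn ℂ w (horizontalStrip δ) ∧
      (∀ x : ℝ, u (x + 1) = u x) ∧ (∀ x : ℝ, w (x + 1) = w x) ∧
      (∀ x : ℝ, f x * w x - g x * u x = 1) ∧
      (∀ x : ℝ, p x * u x + q x * w x = c * f (x + α) + u (x + α)) ∧
      (∀ x : ℝ, r x * u x + s x * w x = c * g (x + α) + w (x + α)) := by
  have hsh : ∀ {F : ℂ → ℂ} (y : ℝ), Function.Periodic F 1 →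
      Function.Periodic (fun z => F (z + y * I)) 1 := fun y hF z => by
    simp only [add_right_comm z 1, hF (z + y * I)]
  have hκy : ∀ y : ℝ, |y| < δ → ∫ x in (0 : ℝ)..1,
      (f (x + y * I) * f (x + y * I) + g (x + y * I) * g (x + y * I)) ≠ 0 := fun y hy => by
    rw [integral_line_eq_integral_ofReal (F := fun z => f z * f z + g z * g z) hy
      ((hfd.mul hfd).add (hgd.mul hgd)) ((hfp.mul hfp).add (hgp.mul hgp))]
    exact hκ
  have hloc : ∀ y : ℝ, ∃ (ε : ℝ) (c : ℂ) (u w : ℂ → ℂ), |y| < δ → 0 < ε ∧ ε ≤ δ - |y| ∧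
      DifferentiableOn ℂ u (horizontalStrip ε) ∧ DifferentiableOn ℂ w (horizontalStrip ε) ∧
      Function.Periodic u 1 ∧ Function.Periodic w 1 ∧
      (∀ z ∈ horizontalStrip ε, f (z + y * I) * w z - g (z + y * I) * u z = 1) ∧
      (∀ z ∈ horizontalStrip ε, p (z + y * I) * u z + q (z + y * I) * w z =
        c * f (z + α + y * I) + u (z + α)) ∧
      (∀ z ∈ horizontalStrip ε, r (z + y * I) * u z + s (z + y * I) * w z =
        c * g (z + α + y * I) + w (z + α)) ∧
      ∀ t : ℝ, |t| < ε →
        ∫ x in (0 : ℝ)..1, (f (x + t * I + y * I) * u (x + t * I) +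
          g (x + t * I + y * I) * w (x + t * I)) = 0 := by
    intro y
    by_cases hy : |y| < δ
    · obtain ⟨ε, hε, hle, c, u, w, h⟩ := exists_normalized_complement_near_line hα
        (sub_pos.2 hy) (hpd.comp_add_mul_I y) (hqd.comp_add_mul_I y) (hrd.comp_add_mul_I y)
        (hsd.comp_add_mul_I y) (hfd.comp_add_mul_I y) (hgd.comp_add_mul_I y)
        (hsh y hpp) (hsh y hqp) (hsh y hrp) (hsh y hsp) (hsh y hfp) (hsh y hgp)
        (fun z hz => hdet _ (add_mul_I_mem_horizontalStrip hz))
        (fun z hz => by rw [add_right_comm]; exact hf _ (add_mul_I_mem_horizontalStrip hz))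
        (fun z hz => by rw [add_right_comm]; exact hg _ (add_mul_I_mem_horizontalStrip hz))
        (fun x => hne _ (ofReal_add_mul_I_mem_horizontalStrip hy x)) (hκy y hy)
      exact ⟨ε, c, u, w, fun _ => ⟨hε, hle, h⟩⟩
    · exact ⟨0, 0, 0, 0, fun h => absurd h hy⟩
  choose ε c u w h using hloc
  have hglue : ∀ y t : ℝ, |y| < δ → |t| < ε y →
      (fun x : ℝ => u (y + t) x) = (fun x : ℝ => u y (x + t * I)) ∧
      (fun x : ℝ => w (y + t) x) = (fun x : ℝ => w y (x + t * I)) := by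
    intro y t hy ht
    obtain ⟨hε, hle, hud, hwd, hup, hwp, hd, hu, hw, hi⟩ := h y hy
    have hyt : |y + t| < δ := by
      have := abs_add_le y t
      linarith
    obtain ⟨hε', -, hud', hwd', hup', hwp', hd', hu', hw', hi'⟩ := h (y + t) hyt
    have hcast : ∀ x : ℂ, x + t * I + y * I = x + ((y + t : ℝ) : ℂ) * I := fun x => by
      push_cast
      ring
    have hpt : ∀ x : ℝ, (x : ℂ) + t * I ∈ horizontalStrip (ε y) :=
      ofReal_add_mul_I_mem_horizontalStrip ht
    have hpr : ∀ x : ℝ, (x : ℂ) ∈ horizontalStrip (ε (y + t)) := ofReal_mem_horizontalStrip hε'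
    have hadd : ∀ x : ℝ, ((x + α : ℝ) : ℂ) + t * I = x + t * I + α := fun x => by
      push_cast
      ring
    have hR : ∀ {F : ℂ → ℂ}, Function.Periodic F 1 →
        Function.Periodic (fun x : ℝ => F x) 1 := fun hF x => by
      simp only [ofReal_add, ofReal_one, hF (x : ℂ)]
    have hδm : ∀ x : ℝ, (x : ℂ) + ((y + t : ℝ) : ℂ) * I ∈ horizontalStrip δ :=
      ofReal_add_mul_I_mem_horizontalStrip hyt
    have hα' : ∀ x : ℝ, ((x + α : ℝ) : ℂ) + ((y + t : ℝ) : ℂ) * I =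
        x + ((y + t : ℝ) : ℂ) * I + α := fun x => by
      push_cast
      ring
    refine normalized_complement_unique hα.1
      (f := fun x => f (x + ((y + t : ℝ) : ℂ) * I)) (g := fun x => g (x + ((y + t : ℝ) : ℂ) * I))
      (p := fun x => p (x + ((y + t : ℝ) : ℂ) * I)) (q := fun x => q (x + ((y + t : ℝ) : ℂ) * I))
      (r := fun x => r (x + ((y + t : ℝ) : ℂ) * I)) (s := fun x => s (x + ((y + t : ℝ) : ℂ) * I))
      (c := c (y + t)) (c' := c y)
      (hfd.continuous_line hyt) (hgd.continuous_line hyt)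
      (hud'.continuous_ofReal hε') (hwd'.continuous_ofReal hε')
      (hud.continuous_line ht) (hwd.continuous_line ht)
      (hR hup') (hR hwp') (hR (hsh t hup)) (hR (hsh t hwp))
      (fun x => hne _ (hδm x))
      (fun x => by simpa only [hα'] using hf _ (hδm x))
      (fun x => by simpa only [hα'] using hg _ (hδm x))
      (fun x => hd' x (hpr x)) (fun x => by simpa only [hcast] using hd _ (hpt x))
      (fun x => by simpa only [ofReal_add] using hu' x (hpr x))
      (fun x => by simpa only [ofReal_add] using hw' x (hpr x))
      (fun x => ?_) (fun x => ?_) (hκy _ hyt) ?_ ?_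
    · have := hu _ (hpt x)
      rwa [← hadd, hcast, hcast] at this
    · have := hw _ (hpt x)
      rwa [← hadd, hcast, hcast] at this
    · simpa using hi' 0 (by simpa using hε')
    · simpa only [hcast] using hi t ht
  have hdiff : ∀ U : ℝ → ℂ → ℂ,
      (∀ y, |y| < δ → DifferentiableOn ℂ (U y) (horizontalStrip (ε y))) →
      (∀ y t : ℝ, |y| < δ → |t| < ε y → ∀ x : ℝ, U (y + t) x = U y (x + t * I)) →
      DifferentiableOn ℂ (fun z => U z.im z.re) (horizontalStrip δ) := by
    intro U hU hUg z₀ hz₀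
    have hε := (h z₀.im hz₀).1
    have hev : (fun z : ℂ => U z.im z.re) =ᶠ[nhds z₀] fun z => U z₀.im (z - z₀.im * I) := by
      have hopen : ∀ᶠ z : ℂ in nhds z₀, |z.im - z₀.im| < ε z₀.im := by
        refine IsOpen.mem_nhds (isOpen_lt (by fun_prop) continuous_const) ?_
        simpa using hε
      filter_upwards [hopen] with z hz
      have := hUg z₀.im (z.im - z₀.im) hz₀ hz z.re
      rw [add_sub_cancel] at this
      rw [this]
      congr 1
      apply Complex.ext <;> simp
    have hd : DifferentiableAt ℂ (fun z => U z₀.im (z - z₀.im * I)) z₀ := by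
      have h1 : z₀ - z₀.im * I ∈ horizontalStrip (ε z₀.im) := by
        simpa [horizontalStrip] using hε
      have h2 := (hU z₀.im hz₀).differentiableAt ((isOpen_horizontalStrip _).mem_nhds h1)
      exact DifferentiableAt.comp z₀ (g := U z₀.im) (f := fun z => z - z₀.im * I) h2 (by fun_prop)
    exact (hd.congr_of_eventuallyEq hev).differentiableWithinAt
  obtain ⟨hε, -, -, -, hup, hwp, hd, hu, hw, -⟩ := h 0 (by simpa using hδ)
  refine ⟨c 0, fun z => u z.im z.re, fun z => w z.im z.re,
    hdiff u (fun y hy => (h y hy).2.2.1) fun y t hy ht => congrFun (hglue y t hy ht).1,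
    hdiff w (fun y hy => (h y hy).2.2.2.1) fun y t hy ht => congrFun (hglue y t hy ht).2,
    fun x => ?_, fun x => ?_, fun x => ?_, fun x => ?_, fun x => ?_⟩
  · simpa using hup x
  · simpa using hwp x
  · simpa using hd x (ofReal_mem_horizontalStrip hε x)
  · simpa using hu x (ofReal_mem_horizontalStrip hε x)
  · simpa using hw x (ofReal_mem_horizontalStrip hε x)

lemma ExtendsHoloStrip.exists_periodic {δ : ℝ} {f : ℝ → ℝ} (hδ : 0 < δ)
    (hf : ExtendsHoloStrip f δ) (hper : Function.Periodic f 1) :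
    ∃ F : ℂ → ℂ, DifferentiableOn ℂ F (horizontalStrip δ) ∧ Function.Periodic F 1 ∧
      ∀ x : ℝ, F x = f x := by
  obtain ⟨F, hF, hFf⟩ := hf
  have hF' : DifferentiableOn ℂ F (horizontalStrip δ) := hF
  have h1 : EqOn (fun z => F (z + (1 : ℝ))) F (horizontalStrip δ) :=
    eqOn_horizontalStrip_of_ofReal hδ (hF'.comp_add_ofReal 1) hF' fun x => by
      rw [← ofReal_add, hFf, hFf, hper x]
  refine ⟨(horizontalStrip δ).indicator F,
    hF'.congr fun z hz => indicator_of_mem hz F, fun z => ?_, fun x => ?_⟩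
  · have hiff : z + 1 ∈ horizontalStrip δ ↔ z ∈ horizontalStrip δ := by
      simpa using add_ofReal_mem_horizontalStrip (z := z) (δ := δ) 1
    by_cases hz : z ∈ horizontalStrip δ
    · rw [indicator_of_mem hz, indicator_of_mem (hiff.2 hz)]
      simpa using h1 hz
    · rw [indicator_of_notMem hz, indicator_of_notMem (mt hiff.1 hz)]
  · rw [indicator_of_mem (ofReal_mem_horizontalStrip hδ x), hFf]

lemma extendsHoloStrip_re {δ : ℝ} {F : ℂ → ℂ} (hF : DifferentiableOn ℂ F (horizontalStrip δ)) :
    ExtendsHoloStrip (fun x => (F x).re) δ := by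
  refine ⟨fun z => (F z + conj (F (conj z))) / 2, (hF.add hF.conj_comp_conj).div_const 2,
    fun x => ?_⟩
  simp only [conj_ofReal, add_conj]
  simp

/-- Puig's reducibility lemma: if `A : ℝ → SL(2,ℝ)` is 1-periodic with entries extending
holomorphically to the strip `{|Im z| < δ}`, and `v` is a nonvanishing 1-periodic analytic
invariant section, i.e. `v(ω + α) = A(ω)v(ω)`, then `A` can be analytically conjugated to a
constant upper-triangular unipotent matrix `[[1, c], [0, 1]]`. -/
theorem puig_reducibility (α δ : ℝ) (hα : IsDiophantine α) (hδ : 0 < δ)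
    (A : ℝ → Matrix.SpecialLinearGroup (Fin 2) ℝ)
    (hAper : ∀ ω : ℝ, A (ω + 1) = A ω)
    (hAhol : ∀ i j : Fin 2,
      ExtendsHoloStrip (fun ω => (A ω : Matrix (Fin 2) (Fin 2) ℝ) i j) δ)
    (v : ℝ → Fin 2 → ℝ)
    (hvper : ∀ ω : ℝ, v (ω + 1) = v ω)
    (hv0 : ∀ ω : ℝ, v ω ≠ 0)
    (hvhol : ∀ i : Fin 2, ExtendsHoloStrip (fun ω => v ω i) δ)
    (hveq : ∀ ω : ℝ, v (ω + α) = (A ω : Matrix (Fin 2) (Fin 2) ℝ).mulVec (v ω)) :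
    ∃ c : ℝ, ∃ B : ℝ → Matrix.SpecialLinearGroup (Fin 2) ℝ,
      (∀ ω : ℝ, B (ω + 1) = B ω) ∧
      (∀ i j : Fin 2,
        ExtendsHoloStrip (fun ω => (B ω : Matrix (Fin 2) (Fin 2) ℝ) i j) δ) ∧
      ∀ ω : ℝ, ((B (ω + α))⁻¹ * A ω * B ω : Matrix.SpecialLinearGroup (Fin 2) ℝ) =
        (!![1, c; 0, 1] : Matrix (Fin 2) (Fin 2) ℝ) := by
  have hper : ∀ i j, Function.Periodic (fun ω => (A ω : Matrix (Fin 2) (Fin 2) ℝ) i j) 1 :=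
    fun i j ω => by simp only [hAper ω]
  have hvp : ∀ i, Function.Periodic (fun ω => v ω i) 1 := fun i ω => by simp only [hvper ω]
  obtain ⟨p, hpd, hpp, hp⟩ := (hAhol 0 0).exists_periodic hδ (hper 0 0)
  obtain ⟨q, hqd, hqp, hq⟩ := (hAhol 0 1).exists_periodic hδ (hper 0 1)
  obtain ⟨r, hrd, hrp, hr⟩ := (hAhol 1 0).exists_periodic hδ (hper 1 0)
  obtain ⟨s, hsd, hsp, hs⟩ := (hAhol 1 1).exists_periodic hδ (hper 1 1)
  obtain ⟨f, hfd, hfp, hf⟩ := (hvhol 0).exists_periodic hδ (hvp 0)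
  obtain ⟨g, hgd, hgp, hg⟩ := (hvhol 1).exists_periodic hδ (hvp 1)
  have hdetR : ∀ x : ℝ, (A x : Matrix (Fin 2) (Fin 2) ℝ) 0 0 * (A x : Matrix (Fin 2) (Fin 2) ℝ) 1 1 -
      (A x : Matrix (Fin 2) (Fin 2) ℝ) 0 1 * (A x : Matrix (Fin 2) (Fin 2) ℝ) 1 0 = 1 := fun x => by
    rw [← Matrix.det_fin_two, (A x).det_coe]
  have hv0eq : ∀ x : ℝ, v (x + α) 0 = (A x : Matrix (Fin 2) (Fin 2) ℝ) 0 0 * v x 0 +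
      (A x : Matrix (Fin 2) (Fin 2) ℝ) 0 1 * v x 1 := fun x => by
    rw [hveq x]
    simp [Matrix.mulVec, dotProduct, Fin.sum_univ_two]
  have hv1eq : ∀ x : ℝ, v (x + α) 1 = (A x : Matrix (Fin 2) (Fin 2) ℝ) 1 0 * v x 0 +
      (A x : Matrix (Fin 2) (Fin 2) ℝ) 1 1 * v x 1 := fun x => by
    rw [hveq x]
    simp [Matrix.mulVec, dotProduct, Fin.sum_univ_two]
  have hvne : ∀ x : ℝ, v x 0 ≠ 0 ∨ v x 1 ≠ 0 := fun x => by
    by_contra! h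
    exact hv0 x (funext fun i => by fin_cases i <;> simp [h.1, h.2])
  have hdet : EqOn (fun z => p z * s z - q z * r z) (fun _ => 1) (horizontalStrip δ) :=
    eqOn_horizontalStrip_of_ofReal hδ ((hpd.mul hsd).sub (hqd.mul hrd)) (by fun_prop)
      fun x => by
        simp only [hp, hq, hr, hs]
        exact_mod_cast hdetR x
  have hfe : EqOn (fun z => f (z + α)) (fun z => p z * f z + q z * g z) (horizontalStrip δ) :=
    eqOn_horizontalStrip_of_ofReal hδ (hfd.comp_add_ofReal α) ((hpd.mul hfd).add (hqd.mul hgd))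
      fun x => by
        simp only [← ofReal_add, hp, hq, hf, hg, hv0eq]
        push_cast
        rfl
  have hge : EqOn (fun z => g (z + α)) (fun z => r z * f z + s z * g z) (horizontalStrip δ) :=
    eqOn_horizontalStrip_of_ofReal hδ (hgd.comp_add_ofReal α) ((hrd.mul hfd).add (hsd.mul hgd))
      fun x => by
        simp only [← ofReal_add, hr, hs, hf, hg, hv1eq]
        push_cast
        rfl
  have hne : ∀ z ∈ horizontalStrip δ, f z ≠ 0 ∨ g z ≠ 0 :=
    invariant_section_ne_zero hα.1 hfd hgd hfp hgp hdet hfe hge (by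
      have := hvne 0
      rw [← ofReal_zero, hf, hg]
      exact_mod_cast this)
  have hvc : ∀ i, Continuous fun x => v x i := fun i => by
    obtain ⟨F, hF, hFv⟩ := hvhol i
    have := Complex.continuous_re.comp (DifferentiableOn.continuous_ofReal hδ hF)
    simpa [Function.comp_def, hFv] using this
  have hκ : ∫ x in (0 : ℝ)..1, (f x * f x + g x * g x) ≠ 0 := by
    have e : (fun x : ℝ => f x * f x + g x * g x) =
        fun x : ℝ => ((v x 0 * v x 0 + v x 1 * v x 1 : ℝ) : ℂ) := by
      funext x
      rw [hf, hg]
      push_cast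
      rfl
    rw [e, intervalIntegral.integral_ofReal, ofReal_ne_zero]
    refine (intervalIntegral.intervalIntegral_pos_of_pos ?_ (fun x => ?_) one_pos).ne'
    · exact (((hvc 0).mul (hvc 0)).add ((hvc 1).mul (hvc 1))).intervalIntegrable _ _
    · rcases hvne x with h | h
      · nlinarith [mul_self_pos.2 h, mul_self_nonneg (v x 1)]
      · nlinarith [mul_self_pos.2 h, mul_self_nonneg (v x 0)]
  obtain ⟨c, u, w, hud, hwd, hup, hwp, hd, hu, hw⟩ := exists_complement hα hδ hpd hqd hrd hsd hfd hgd
    hpp hqp hrp hsp hfp hgp hdet hfe hge hne hκ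
  have hd' : ∀ x : ℝ, v x 0 * (w x).re - (u x).re * v x 1 = 1 := fun x => by
    have := congrArg Complex.re (hd x)
    rw [hf, hg, sub_re, re_ofReal_mul, re_ofReal_mul, one_re] at this
    linarith
  have hu' : ∀ x : ℝ, (A x : Matrix (Fin 2) (Fin 2) ℝ) 0 0 * (u x).re +
      (A x : Matrix (Fin 2) (Fin 2) ℝ) 0 1 * (w x).re =
      v (x + α) 0 * c.re + (u ((x + α : ℝ) : ℂ)).re := fun x => by
    have := congrArg Complex.re (hu x)
    rw [← ofReal_add, hp, hq, hf, add_re, add_re, re_ofReal_mul, re_ofReal_mul,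
      re_mul_ofReal] at this
    linarith
  have hw' : ∀ x : ℝ, (A x : Matrix (Fin 2) (Fin 2) ℝ) 1 0 * (u x).re +
      (A x : Matrix (Fin 2) (Fin 2) ℝ) 1 1 * (w x).re =
      v (x + α) 1 * c.re + (w ((x + α : ℝ) : ℂ)).re := fun x => by
    have := congrArg Complex.re (hw x)
    rw [← ofReal_add, hr, hs, hg, add_re, add_re, re_ofReal_mul, re_ofReal_mul,
      re_mul_ofReal] at this
    linarith
  obtain ⟨B, hB⟩ : ∃ B : ℝ → Matrix.SpecialLinearGroup (Fin 2) ℝ, ∀ ω : ℝ,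
      (B ω : Matrix (Fin 2) (Fin 2) ℝ) = !![v ω 0, (u ω).re; v ω 1, (w ω).re] :=
    ⟨fun ω => ⟨!![v ω 0, (u ω).re; v ω 1, (w ω).re], by rw [Matrix.det_fin_two_of, hd' ω]⟩,
      fun _ => rfl⟩
  obtain ⟨C, hC⟩ : ∃ C : Matrix.SpecialLinearGroup (Fin 2) ℝ,
      (C : Matrix (Fin 2) (Fin 2) ℝ) = !![1, c.re; 0, 1] :=
    ⟨⟨!![1, c.re; 0, 1], by simp [Matrix.det_fin_two_of]⟩, rfl⟩
  refine ⟨c.re, B, fun ω => ?_, fun i j => ?_, fun ω => ?_⟩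
  · apply Subtype.ext
    simp [hB, hvper ω, hup ω, hwp ω]
  · simp only [hB]
    fin_cases i <;> fin_cases j
    · exact hvhol 0
    · exact extendsHoloStrip_re hud
    · exact hvhol 1
    · exact extendsHoloStrip_re hwd
  · have hconj : (B (ω + α))⁻¹ * A ω * B ω = C := by
      rw [mul_assoc, inv_mul_eq_iff_eq_mul]
      apply Subtype.ext
      rw [Matrix.SpecialLinearGroup.coe_mul, Matrix.SpecialLinearGroup.coe_mul, hB, hB, hC]
      ext i j
      fin_cases i <;> fin_cases j
      · simp [Matrix.mul_apply, Fin.sum_univ_two, hv0eq]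
      · simpa [Matrix.mul_apply, Fin.sum_univ_two] using hu' ω
      · simp [Matrix.mul_apply, Fin.sum_univ_two, hv1eq]
      · simpa [Matrix.mul_apply, Fin.sum_univ_two] using hw' ω
    rw [hconj, hC]
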